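/- With δ_λ = Me_{Z_λ} − λ − 1/3, one has limsup_{λ→∞} λ·δ_λ = 4/135. -/

import Mathlib

open MeasureTheory ProbabilityTheory Filter Real Set
open scoped ENNReal NNReal

/-- Distribution of `Z_λ = N_λ + U`, `N_λ` Poisson(λ), `U` uniform on `(0,1)`, independent. -/
noncomputable def zMeasure (l : ℝ) : Measure ℝ :=
  Measure.map (fun p : ℝ × ℝ => p.1 + p.2)
    ((Measure.map (Nat.cast : ℕ → ℝ) (poissonMeasure l.toNNReal)).prod
      (volume.restrict (Set.Ioo (0 : ℝ) 1)))

/-- The median of `Z_λ`: `inf {t : P(Z_λ ≤ t) ≥ 1/2}`. -/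
noncomputable def medianZ (l : ℝ) : ℝ :=
  sInf {t : ℝ | (1 : ℝ≥0∞) / 2 ≤ zMeasure l (Set.Iic t)}

/-- The function `H` of the main theorem. -/
noncomputable def Hfun (x : ℝ) : ℝ :=
  if x ≤ 2 / 3 then x ^ 2 * (x - 1) / 3 + 4 / 135
  else x / 3 * (x ^ 2 - 4 * x + 5) - 86 / 135

/-- `w_n(x,k) = P(Z_{n+x} ≤ n + x + 1/3 + k/(n+x))`. -/
noncomputable def w (n : ℕ) (x k : ℝ) : ℝ :=
  (zMeasure (n + x) (Set.Iic ((n : ℝ) + x + 1 / 3 + k / (n + x)))).toReal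

/-- `r_n(x,k) = k/(n+x)`. -/
noncomputable def r (n : ℕ) (x k : ℝ) : ℝ := k / (n + x)

/-- `g_n(u) = e^{-u} u^n`. -/
noncomputable def g (n : ℕ) (u : ℝ) : ℝ := Real.exp (-u) * u ^ n

/-- `c_n(v,x) = ((n+v+x)/(n+1+x))^{n+1} e^{1-v}`. -/
noncomputable def c (n : ℕ) (v x : ℝ) : ℝ :=
  (((n : ℝ) + v + x) / ((n : ℝ) + 1 + x)) ^ (n + 1) * Real.exp (1 - v)

/-- `Δ_n(x,k) = ((n+1)!/g_{n+1}(n+1+x)) (w_{n+1}(x,k) - w_n(x,k))`. -/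
noncomputable def Δfun (n : ℕ) (x k : ℝ) : ℝ :=
  ((n + 1).factorial : ℝ) / g (n + 1) ((n : ℝ) + 1 + x) * (w (n + 1) x k - w n x k)

open scoped Topology

/-- The mass that the Poisson law of parameter `l` gives to `n`. -/
noncomputable def poissonMass (n : ℕ) (l : ℝ) : ℝ := exp (-l) * l ^ n / n.factorial

/-- The probability that a Poisson variable of parameter `l` is less than `n`. -/
noncomputable def poissonLower (n : ℕ) (l : ℝ) : ℝ := ∑ k ∈ Finset.range n, poissonMass k l

/-- The ratio of `poissonMass (n - 1) (n + u)` to `poissonMass n n`. -/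
noncomputable def massRatio (n : ℕ) (u : ℝ) : ℝ := exp (-u) * (1 + u / n) ^ (n - 1)

lemma poissonMass_nonneg (n : ℕ) {l : ℝ} (hl : 0 ≤ l) : 0 ≤ poissonMass n l := by
  unfold poissonMass; positivity

lemma poissonMass_self_pos {n : ℕ} (hn : 0 < n) : 0 < poissonMass n n := by
  unfold poissonMass; positivity

lemma poissonMass_add_eq {n : ℕ} (hn : 0 < n) (u : ℝ) :
    poissonMass n (n + u) = poissonMass n n * (massRatio n u * (1 + u / n)) := by
  have h : massRatio n u * (1 + u / n) = exp (-u) * (1 + u / n) ^ n := by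
    rw [massRatio, mul_assoc, pow_sub_one_mul hn.ne']
  have h' : ((n : ℝ) + u) = n * (1 + u / n) := by field_simp
  rw [h, poissonMass, poissonMass, neg_add, exp_add]
  rw [h', mul_pow]
  ring

lemma poissonMass_pred_add_eq {n : ℕ} (hn : 0 < n) (u : ℝ) :
    poissonMass (n - 1) (n + u) = poissonMass n n * massRatio n u := by
  obtain ⟨m, rfl⟩ : ∃ m, n = m + 1 := ⟨n - 1, by omega⟩
  have h' : (((m + 1 : ℕ) : ℝ) + u) = (m + 1 : ℕ) * (1 + u / (m + 1 : ℕ)) := by field_simp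
  simp only [poissonMass, massRatio, neg_add, exp_add, Nat.add_sub_cancel]
  rw [h', mul_pow, pow_succ (_ : ℝ) m, Nat.factorial_succ]
  push_cast
  field_simp

lemma poissonMass_succ_self (n : ℕ) :
    poissonMass (n + 1) (n + 1 : ℕ) = poissonMass n (n + 1 : ℕ) := by
  simp only [poissonMass, pow_succ, Nat.factorial_succ]
  push_cast
  field_simp

lemma hasDerivAt_poissonLower_succ (n : ℕ) (l : ℝ) :
    HasDerivAt (poissonLower (n + 1)) (-poissonMass n l) l := by
  induction n with
  | zero =>
    have : poissonLower (0 + 1) = fun l => exp (-l) := by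
      funext l; simp [poissonLower, poissonMass]
    rw [this]
    simpa [poissonMass] using (hasDerivAt_neg l).exp
  | succ n ih =>
    have h : poissonLower (n + 1 + 1) = fun l => poissonLower (n + 1) l + poissonMass (n + 1) l := by
      funext l; simp [poissonLower, Finset.sum_range_succ]
    rw [h]
    have h2 := ((hasDerivAt_neg l).exp.mul (hasDerivAt_pow (n + 1) l)).div_const
      ((n + 1).factorial : ℝ)
    refine (ih.add h2).congr_deriv ?_
    simp only [poissonMass, Nat.factorial_succ, Nat.add_sub_cancel]
    push_cast
    field_simp
    ring

lemma hasDerivAt_poissonLower {n : ℕ} (hn : 0 < n) (l : ℝ) :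
    HasDerivAt (poissonLower n) (-poissonMass (n - 1) l) l := by
  obtain ⟨m, rfl⟩ : ∃ m, n = m + 1 := ⟨n - 1, by omega⟩
  exact hasDerivAt_poissonLower_succ m l

lemma exists_massRatio_eq_exp {n : ℕ} (hn : 4 ≤ n) {u : ℝ} (hu : |u| ≤ 1) :
    ∃ S : ℝ, |S| ≤ 7 / 3 ∧ massRatio n u = exp (-(u + u ^ 2 / 2) * (1 / n)
      + (u ^ 2 / 2 + u ^ 3 / 3) * (1 / n) ^ 2 + S * (1 / n) ^ 3) := by
  have hn' : (4 : ℝ) ≤ n := by exact_mod_cast hn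
  have hmul : (n : ℝ) * (1 / n) = 1 := by field_simp
  have hh0 : 0 < 1 / (n : ℝ) := by positivity
  have hh : 1 / (n : ℝ) ≤ 1 / 4 := by gcongr
  have hdiv : u / n = u * (1 / n) := by ring
  rw [massRatio, hdiv]
  generalize 1 / (n : ℝ) = h at *
  have huh : |u * h| ≤ h := by
    rw [abs_mul, abs_of_pos hh0]; nlinarith
  have huh4 := abs_le.1 (huh.trans hh)
  set R : ℝ := log (1 + u * h) - (u * h - (u * h) ^ 2 / 2 + (u * h) ^ 3 / 3) with hR
  have hRb : |R| ≤ 2 * h ^ 4 := by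
    have h1 := abs_log_sub_add_sum_range_le (x := -(u * h)) (by rw [abs_neg]; linarith) 3
    have h2 : (∑ i ∈ Finset.range 3, (-(u * h)) ^ (i + 1) / ((i : ℝ) + 1)) +
        log (1 - -(u * h)) = R := by
      simp only [Finset.sum_range_succ, Finset.sum_range_zero, hR, sub_neg_eq_add]
      push_cast
      ring
    rw [h2, abs_neg] at h1
    refine h1.trans ?_
    rw [div_le_iff₀ (by linarith)]
    have h3 : |u * h| ^ (3 + 1) ≤ h ^ 4 := by gcongr
    have h4 : 0 ≤ h ^ 4 := by positivity
    nlinarith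
  refine ⟨-u ^ 3 / 3 + (1 - h) * (R / h ^ 4), ?_, ?_⟩
  · have hRS : |R / h ^ 4| ≤ 2 := by
      rw [abs_div, abs_of_pos (by positivity : 0 < h ^ 4), div_le_iff₀ (by positivity)]
      exact hRb
    have hu3 : |u ^ 3| ≤ 1 := by rw [abs_pow]; exact pow_le_one₀ (abs_nonneg _) hu
    have h1 : |(1 - h) * (R / h ^ 4)| ≤ 2 := by
      rw [abs_mul, abs_of_pos (by linarith)]; nlinarith [abs_nonneg (R / h ^ 4)]
    obtain ⟨h2, h3⟩ := abs_le.1 h1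
    obtain ⟨h4, h5⟩ := abs_le.1 hu3
    rw [abs_le]
    constructor <;> linarith
  · have hpos : 0 < 1 + u * h := by linarith
    have hlog : log (1 + u * h) = R + (u * h - (u * h) ^ 2 / 2 + (u * h) ^ 3 / 3) := by
      rw [hR]; ring
    have hn1 : ((n - 1 : ℕ) : ℝ) = n - 1 := by
      rw [Nat.cast_sub (by omega)]; simp
    have hn2 : (n : ℝ) = 1 / h := by rw [eq_div_iff hh0.ne']; exact hmul
    rw [← exp_log (pow_pos hpos (n - 1)), ← exp_add, Real.log_pow, hlog, hn1, hn2]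
    congr 1
    clear_value R
    field_simp
    ring

lemma abs_exp_sub_quadratic_le {h A B S : ℝ} (hh0 : 0 < h) (hh : h ≤ 1 / 4) (hA : |A| ≤ 3 / 2)
    (hB : |B| ≤ 1) (hS : |S| ≤ 7 / 3) :
    |exp (-A * h + B * h ^ 2 + S * h ^ 3) - (1 - A * h + (B + A ^ 2 / 2) * h ^ 2)|
      ≤ 40 * h ^ 3 := by
  have hT : |B + S * h| ≤ 2 := by
    calc |B + S * h| ≤ |B| + |S| * |h| := (abs_add_le _ _).trans_eq (by rw [abs_mul])
      _ ≤ 1 + 7 / 3 * (1 / 4) := by rw [abs_of_pos hh0]; gcongr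
      _ ≤ 2 := by norm_num
  have hzT : -A * h + B * h ^ 2 + S * h ^ 3 = h * (-A + h * (B + S * h)) := by ring
  have hmain : 1 + h * (-A + h * (B + S * h)) + (h * (-A + h * (B + S * h))) ^ 2 / 2
      - (1 - A * h + (B + A ^ 2 / 2) * h ^ 2)
      = h ^ 3 * (S - A * (B + S * h) + h * (B + S * h) ^ 2 / 2) := by ring
  rw [hzT]
  generalize B + S * h = T at *
  have hzb : |h * (-A + h * T)| ≤ 2 * h := by
    rw [abs_mul, abs_of_pos hh0, mul_comm]
    gcongr
    calc |-A + h * T| ≤ |A| + h * |T| :=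
          (abs_add_le _ _).trans_eq (by rw [abs_neg, abs_mul, abs_of_pos hh0])
      _ ≤ 3 / 2 + 1 / 4 * 2 := by gcongr
      _ = 2 := by norm_num
  have hmainb : |S - A * T + h * T ^ 2 / 2| ≤ 32 := by
    have h1 : |A * T| ≤ 3 / 2 * 2 := by rw [abs_mul]; gcongr
    have h2 : |h * T ^ 2 / 2| ≤ 1 / 4 * 2 ^ 2 / 2 := by
      rw [abs_div, abs_mul, abs_pow, abs_of_pos hh0, abs_of_pos (by norm_num : (0 : ℝ) < 2)]
      gcongr
    obtain ⟨h3, h4⟩ := abs_le.1 h1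
    obtain ⟨h5, h6⟩ := abs_le.1 h2
    obtain ⟨h7, h8⟩ := abs_le.1 hS
    rw [abs_le]
    constructor <;> linarith
  generalize h * (-A + h * T) = z at *
  have hexpb : |exp z - (1 + z + z ^ 2 / 2)| ≤ 8 * h ^ 3 := by
    have h1 := Real.exp_bound (x := z) (by linarith) (n := 3) (by norm_num)
    have h2 : ∑ m ∈ Finset.range 3, z ^ m / (m.factorial : ℝ) = 1 + z + z ^ 2 / 2 := by
      simp [Finset.sum_range_succ, Nat.factorial]
    rw [h2] at h1
    have h3 : |z| ^ 3 ≤ (2 * h) ^ 3 := by gcongr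
    have h4 : (Nat.succ 3 : ℝ) / (Nat.factorial 3 * (3 : ℕ)) ≤ 1 := by norm_num [Nat.factorial]
    calc _ ≤ |z| ^ 3 * 1 := h1.trans (by gcongr)
      _ ≤ 8 * h ^ 3 := by linarith
  calc _ = |(exp z - (1 + z + z ^ 2 / 2)) + h ^ 3 * (S - A * T + h * T ^ 2 / 2)| := by
        rw [← hmain]; ring_nf
    _ ≤ 8 * h ^ 3 + h ^ 3 * 32 := by
      refine (abs_add_le _ _).trans ?_
      rw [abs_mul (h ^ 3), abs_of_pos (by positivity : 0 < h ^ 3)]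
      gcongr
    _ = 40 * h ^ 3 := by ring

/-- Second order expansion of `massRatio n u` in powers of `1 / n`, uniformly in `u`. -/
lemma abs_massRatio_sub_le {n : ℕ} (hn : 4 ≤ n) {u : ℝ} (hu : |u| ≤ 1) :
    |massRatio n u - (1 - (u + u ^ 2 / 2) * (1 / n)
      + (u ^ 2 + 5 / 6 * u ^ 3 + u ^ 4 / 8) * (1 / n) ^ 2)| ≤ 40 * (1 / (n : ℝ)) ^ 3 := by
  have hn' : (4 : ℝ) ≤ n := by exact_mod_cast hn
  obtain ⟨S, hS, hE⟩ := exists_massRatio_eq_exp hn hu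
  obtain ⟨hu1, hu2⟩ := abs_le.1 hu
  have hu3 : |u ^ 3| ≤ 1 := by rw [abs_pow]; exact pow_le_one₀ (abs_nonneg _) hu
  obtain ⟨hu4, hu5⟩ := abs_le.1 hu3
  have hA : |u + u ^ 2 / 2| ≤ 3 / 2 := by rw [abs_le]; constructor <;> nlinarith
  have hB : |u ^ 2 / 2 + u ^ 3 / 3| ≤ 1 := by rw [abs_le]; constructor <;> nlinarith
  have key := abs_exp_sub_quadratic_le (h := 1 / (n : ℝ)) (by positivity) (by gcongr) hA hB hS
  rw [hE]
  convert! key using 5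
  ring

/-- Integrated form of `abs_massRatio_sub_le`. -/
lemma abs_poissonLower_add_sub_le {n : ℕ} (hn : 4 ≤ n) {x : ℝ} (hx : |x| ≤ 1) :
    |poissonLower n (n + x) - poissonLower n n + poissonMass n n *
      (x - (x ^ 2 / 2 + x ^ 3 / 6) * (1 / n)
        + (x ^ 3 / 3 + 5 / 24 * x ^ 4 + x ^ 5 / 40) * (1 / n) ^ 2)|
      ≤ poissonMass n n * (40 * (1 / (n : ℝ)) ^ 3) := by
  have hn0 : 0 < n := by omega
  set p := poissonMass n n with hp
  have hp0 : 0 < p := poissonMass_self_pos hn0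
  set h : ℝ := 1 / n with hh
  set F : ℝ → ℝ := fun x => poissonLower n (n + x) + p *
      (x - (x ^ 2 / 2 + x ^ 3 / 6) * h + (x ^ 3 / 3 + 5 / 24 * x ^ 4 + x ^ 5 / 40) * h ^ 2) with hF
  set F' : ℝ → ℝ := fun u => -(p * (massRatio n u - (1 - (u + u ^ 2 / 2) * h
      + (u ^ 2 + 5 / 6 * u ^ 3 + u ^ 4 / 8) * h ^ 2))) with hF'
  have hder (u : ℝ) : HasDerivAt F (F' u) u := by
    have h1 : HasDerivAt (fun u : ℝ => poissonLower n (n + u)) (-poissonMass (n - 1) (n + u)) u :=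
      (hasDerivAt_poissonLower hn0 (n + u)).comp_const_add _ _
    have hpw (k : ℕ) := hasDerivAt_pow k u
    have h2 : HasDerivAt (fun x : ℝ => p * (x - (x ^ 2 / 2 + x ^ 3 / 6) * h
        + (x ^ 3 / 3 + 5 / 24 * x ^ 4 + x ^ 5 / 40) * h ^ 2)) _ u :=
      ((((hasDerivAt_id u).sub ((((hpw 2).div_const 2).add ((hpw 3).div_const 6)).mul_const h)).add
        (((((hpw 3).div_const 3).add ((hpw 4).const_mul (5 / 24))).add
          ((hpw 5).div_const 40)).mul_const (h ^ 2))).const_mul p)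
    refine (h1.add h2).congr_deriv ?_
    rw [poissonMass_pred_add_eq hn0, hF']
    push_cast
    ring
  have hb : ∀ u ∈ Icc (-1 : ℝ) 1, ‖F' u‖ ≤ p * (40 * h ^ 3) := fun u hu => by
    rw [hF', Real.norm_eq_abs, abs_neg, abs_mul, abs_of_pos hp0]
    exact mul_le_mul_of_nonneg_left (abs_massRatio_sub_le hn (abs_le.2 hu)) hp0.le
  have key := (convex_Icc (-1 : ℝ) 1).norm_image_sub_le_of_norm_hasDerivWithin_le
    (fun u _ => (hder u).hasDerivWithinAt) hb (x := 0) (y := x) (by simp) (abs_le.1 hx)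
  have hC : 0 ≤ p * (40 * h ^ 3) := by positivity
  rw [sub_zero, Real.norm_eq_abs, Real.norm_eq_abs] at key
  have e : F x - F 0 = poissonLower n (n + x) - poissonLower n n + p *
      (x - (x ^ 2 / 2 + x ^ 3 / 6) * h + (x ^ 3 / 3 + 5 / 24 * x ^ 4 + x ^ 5 / 40) * h ^ 2) := by
    simp [hF]; ring
  rw [← e]
  exact key.trans (mul_le_of_le_one_right hC hx)

lemma volume_Ioo_inter_Iic (a : ℝ) :
    volume.restrict (Ioo (0 : ℝ) 1) (Iic a) = ENNReal.ofReal (min a 1) := by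
  rw [Measure.restrict_apply measurableSet_Iic]
  have h1 : volume (Iic a ∩ Ioo (0 : ℝ) 1) = volume (Iic a ∩ Ioc (0 : ℝ) 1) :=
    measure_congr ((ae_eq_refl _).inter Ioo_ae_eq_Ioc)
  have h2 : Iic a ∩ Ioc (0 : ℝ) 1 = Ioc 0 (min a 1) := by
    ext x; simp only [mem_inter_iff, mem_Iic, mem_Ioc, le_min_iff]; tauto
  rw [h1, h2, Real.volume_Ioc, sub_zero]

lemma zMeasure_Iic {l : ℝ} (hl : 0 ≤ l) (t : ℝ) :
    zMeasure l (Iic t) =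
      ∑' k : ℕ, ENNReal.ofReal (poissonMass k l) * ENNReal.ofReal (min (t - k) 1) := by
  have hmeas : Measurable (fun p : ℝ × ℝ => p.1 + p.2) := by fun_prop
  rw [zMeasure, Measure.map_apply hmeas measurableSet_Iic,
    Measure.prod_apply (hmeas measurableSet_Iic)]
  have hsec (x : ℝ) : volume.restrict (Ioo (0 : ℝ) 1)
      (Prod.mk x ⁻¹' ((fun p : ℝ × ℝ => p.1 + p.2) ⁻¹' Iic t)) =
      ENNReal.ofReal (min (t - x) 1) := by
    rw [← volume_Ioo_inter_Iic]
    congr 1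
    ext y
    simp [le_sub_iff_add_le']
  simp_rw [hsec]
  rw [lintegral_map (by fun_prop) .of_discrete, poissonMeasure, lintegral_sum_measure]
  refine tsum_congr fun k => ?_
  rw [lintegral_smul_measure, lintegral_dirac]
  simp [poissonMass, Real.coe_toNNReal _ hl]

lemma zMeasure_Iic_nat_add {l : ℝ} (hl : 0 ≤ l) (n : ℕ) {s : ℝ} (hs0 : 0 ≤ s) (hs1 : s ≤ 1) :
    zMeasure l (Iic (n + s)) = ENNReal.ofReal (poissonLower n l + s * poissonMass n l) := by
  rw [zMeasure_Iic hl, tsum_eq_sum (s := Finset.range (n + 1)), Finset.sum_range_succ]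
  · rw [poissonLower, ENNReal.ofReal_add (Finset.sum_nonneg fun k _ => poissonMass_nonneg k hl)
      (mul_nonneg hs0 (poissonMass_nonneg n hl)),
      ENNReal.ofReal_sum_of_nonneg fun k _ => poissonMass_nonneg k hl]
    congr 1
    · refine Finset.sum_congr rfl fun k hk => ?_
      have : (k : ℝ) + 1 ≤ n := by exact_mod_cast Finset.mem_range.1 hk
      rw [min_eq_right (by linarith)]
      simp
    · rw [add_sub_cancel_left, min_eq_left hs1, mul_comm, ENNReal.ofReal_mul hs0]
  · intro k hk
    have : (n : ℝ) + 1 ≤ k := by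
      have : n + 1 ≤ k := by simpa using hk
      exact_mod_cast this
    rw [ENNReal.ofReal_of_nonpos (p := min _ _) ((min_le_left _ _).trans (by linarith)), mul_zero]

lemma tendsto_charFun_standardized_poisson (t : ℝ) :
    Tendsto (fun n : ℕ => charFun (((poissonMeasure (n : ℝ≥0)).map (Nat.cast : ℕ → ℝ)).map
      (fun x => (√(n : ℝ))⁻¹ * (x - n))) t) atTop (𝓝 (charFun (gaussianReal 0 1) t)) := by
  set z : ℕ → ℂ := fun n => ((√(n : ℝ))⁻¹ * t : ℝ) * Complex.I with hz
  have hz0 : Tendsto z atTop (𝓝 0) := by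
    have h1 : Tendsto (fun n : ℕ => (√(n : ℝ))⁻¹ * t) atTop (𝓝 0) := by
      simpa using (tendsto_inv_atTop_zero.comp
        (Real.tendsto_sqrt_atTop.comp tendsto_natCast_atTop_atTop)).mul_const t
    simpa [hz] using ((Complex.continuous_ofReal.tendsto 0).comp h1).mul_const Complex.I
  have hnz : ∀ᶠ n : ℕ in atTop, (n : ℂ) * z n ^ 2 = -t ^ 2 := by
    filter_upwards [eventually_gt_atTop 0] with n hn
    have h1 : ((√(n : ℝ) : ℝ) : ℂ) ^ 2 = n := by
      rw [← Complex.ofReal_pow, Real.sq_sqrt n.cast_nonneg]; simp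
    have h2 : ((√(n : ℝ) : ℝ) : ℂ) ≠ 0 := by
      rw [Complex.ofReal_ne_zero]; positivity
    simp only [hz, mul_pow, Complex.ofReal_mul, Complex.ofReal_inv, inv_pow, Complex.I_sq, h1]
    have : (n : ℂ) ≠ 0 := by exact_mod_cast hn.ne'
    field_simp
  have hexp : Tendsto (fun n : ℕ => (n : ℂ) * (Complex.exp (z n) - 1 - z n)) atTop
      (𝓝 (-t ^ 2 / 2)) := by
    have ho := (Complex.exp_sub_sum_range_succ_isLittleO_pow 2).comp_tendsto hz0
    have ho2 := (Asymptotics.isBigO_refl (fun n : ℕ => (n : ℂ)) atTop).mul_isLittleO ho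
    have hO : (fun n : ℕ => (n : ℂ) * z n ^ 2) =O[atTop] fun _ => (1 : ℂ) :=
      (Asymptotics.isBigO_const_const (-(t : ℂ) ^ 2) one_ne_zero atTop).congr'
        (hnz.mono fun n hn => hn.symm) .rfl
    have ho3 := (Asymptotics.isLittleO_one_iff ℂ).1 (ho2.trans_isBigO hO)
    have h := ho3.add_const (-(t : ℂ) ^ 2 / 2)
    rw [zero_add] at h
    refine h.congr' ?_
    filter_upwards [hnz] with n hn
    rw [← hn]
    simp [Finset.sum_range_succ, Nat.factorial]
    ring
  have hgauss : charFun (gaussianReal 0 1) t = Complex.exp (-t ^ 2 / 2) := by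
    rw [charFun_gaussianReal]
    congr 1
    simp
    ring
  rw [hgauss]
  refine hexp.cexp.congr fun n => ?_
  have hcomp : (fun x : ℝ => (√(n : ℝ))⁻¹ * (x - n)) =
      (fun x => (√(n : ℝ))⁻¹ * x) ∘ (fun x => x + -(n : ℝ)) := by
    ext; simp [sub_eq_add_neg]
  rw [hcomp, ← Measure.map_map (by fun_prop) (by fun_prop), charFun_map_mul, charFun_map_add_const,
    charFun_map_cast_poissonMeasure, ← Complex.exp_add]
  congr 1
  simp only [hz, RCLike.inner_apply, conj_trivial]
  push_cast
  ring

lemma gaussianReal_Iio_zero : gaussianReal 0 1 (Iio 0) = 1 / 2 := by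
  have h1 : gaussianReal 0 1 (Iio 0) = gaussianReal 0 1 (Ioi 0) := by
    conv_lhs => rw [← neg_zero, ← gaussianReal_map_neg]
    rw [Measure.map_apply (by fun_prop) measurableSet_Iio]
    congr 1
    ext x
    simp
  have h2 : gaussianReal 0 1 (Iio 0) + gaussianReal 0 1 (Ici 0) = 1 := by
    rw [← compl_Iio]; exact prob_add_prob_compl measurableSet_Iio
  have := nullSingletonClass_gaussianReal (μ := 0) (v := 1) one_ne_zero
  rw [← measure_congr (Ioi_ae_eq_Ici (μ := gaussianReal 0 1) (a := (0 : ℝ))), ← h1, ← two_mul] at h2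
  rw [ENNReal.eq_div_iff (by simp) (by simp), h2]

lemma poissonMeasure_Iio (n : ℕ) {l : ℝ≥0} :
    poissonMeasure l (Iio n) = ENNReal.ofReal (poissonLower n l) := by
  have : (Iio n : Set ℕ) = ↑(Finset.range n) := by ext; simp
  rw [this, ← sum_measure_singleton, poissonLower,
    ENNReal.ofReal_sum_of_nonneg fun k _ => poissonMass_nonneg k l.coe_nonneg]
  exact Finset.sum_congr rfl fun k _ => poissonMeasure_singleton l k

/-- The Poisson law of integer parameter `n` gives asymptotically mass `1 / 2` to `[0, n)`. -/
lemma tendsto_poissonLower_self :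
    Tendsto (fun n : ℕ => poissonLower n n) atTop (𝓝 (1 / 2)) := by
  have hm (n : ℕ) : IsProbabilityMeasure (((poissonMeasure (n : ℝ≥0)).map (Nat.cast : ℕ → ℝ)).map
      (fun x => (√(n : ℝ))⁻¹ * (x - n))) := Measure.isProbabilityMeasure_map (by fun_prop)
  let μs : ℕ → ProbabilityMeasure ℝ := fun n => ⟨_, hm n⟩
  let μ : ProbabilityMeasure ℝ := ⟨gaussianReal 0 1, inferInstance⟩
  have hlim : Tendsto μs atTop (𝓝 μ) :=
    ProbabilityMeasure.tendsto_iff_tendsto_charFun.2 tendsto_charFun_standardized_poisson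
  have := nullSingletonClass_gaussianReal (μ := 0) (v := 1) one_ne_zero
  have h1 := ProbabilityMeasure.tendsto_measure_of_null_frontier_of_tendsto' hlim (E := Iio 0)
    (by rw [frontier_Iio]; exact measure_singleton (μ := gaussianReal 0 1) 0)
  have h2 : (μ : Measure ℝ) (Iio 0) = 1 / 2 := gaussianReal_Iio_zero
  rw [h2] at h1
  have h3 := (ENNReal.tendsto_toReal (by simp)).comp h1
  have h4 : (1 / 2 : ℝ≥0∞).toReal = 1 / 2 := by simp
  rw [h4] at h3
  refine h3.congr' ?_
  filter_upwards [eventually_gt_atTop 0] with n hn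
  have hpre : (Nat.cast : ℕ → ℝ) ⁻¹' ((fun x : ℝ => (√(n : ℝ))⁻¹ * (x - n)) ⁻¹' Iio 0) = Iio n := by
    ext k
    have : 0 < (√(n : ℝ))⁻¹ := by positivity
    simp [mul_neg_iff, this, this.not_gt]
  have h5 : (μs n : Measure ℝ) (Iio 0) = ENNReal.ofReal (poissonLower n n) := by
    change (((poissonMeasure (n : ℝ≥0)).map (Nat.cast : ℕ → ℝ)).map
      (fun x => (√(n : ℝ))⁻¹ * (x - n))) (Iio 0) = _
    rw [Measure.map_apply (by fun_prop) measurableSet_Iio,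
      Measure.map_apply .of_discrete (measurableSet_Iio.preimage (by fun_prop)), hpre,
      poissonMeasure_Iio]
    simp
  rw [Function.comp_apply, h5, ENNReal.toReal_ofReal]
  exact Finset.sum_nonneg fun k _ => poissonMass_nonneg k n.cast_nonneg

lemma tendsto_poissonMass_self :
    Tendsto (fun n : ℕ => poissonMass n n) atTop (𝓝 0) := by
  have h1 : Tendsto (fun n : ℕ => √(2 * n : ℝ)) atTop atTop :=
    Real.tendsto_sqrt_atTop.comp (tendsto_natCast_atTop_atTop.const_mul_atTop (by norm_num))
  have h2 := (h1.atTop_mul_pos (by positivity) Stirling.tendsto_stirlingSeq_sqrt_pi).inv_tendsto_atTop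
  refine h2.congr' ?_
  filter_upwards [eventually_gt_atTop 0] with n hn
  simp only [Pi.inv_apply, Stirling.stirlingSeq, poissonMass, div_pow, ← Real.exp_nat_mul, mul_one,
    Real.exp_neg]
  field_simp

/-- The value at `n + 1 / 3 + k / n` of the distribution function of `Z_n`. -/
noncomputable def integerCdf (k : ℝ) (n : ℕ) : ℝ :=
  poissonLower n n + (1 / 3 + k / n) * poissonMass n n

lemma tendsto_integerCdf (k : ℝ) : Tendsto (integerCdf k) atTop (𝓝 (1 / 2)) := by
  have h1 : Tendsto (fun n : ℕ => 1 / 3 + k / (n : ℝ)) atTop (𝓝 (1 / 3 + 0)) :=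
    (tendsto_const_div_atTop_nhds_zero_nat k).const_add _
  have h2 := tendsto_poissonLower_self.add (h1.mul tendsto_poissonMass_self)
  rwa [mul_zero, add_zero] at h2

lemma abs_integerCdf_succ_sub_le {n : ℕ} (hn : 4 ≤ n) {k : ℝ} (hk : |k| ≤ 1) :
    |integerCdf k (n + 1) - integerCdf k n
      - poissonMass n n * ((1 / (n : ℝ)) ^ 2 * (2 / 45 - 3 / 2 * k))|
      ≤ poissonMass n n * (125 * (1 / (n : ℝ)) ^ 3) := by
  have hn0 : 0 < n := by omega
  have hn' : (4 : ℝ) ≤ n := by exact_mod_cast hn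
  have hp0 := poissonMass_self_pos hn0
  have hJ := abs_poissonLower_add_sub_le hn (x := 1) (by simp)
  have hE := abs_massRatio_sub_le hn (u := 1) (by simp)
  have hh0 : 0 < 1 / (n : ℝ) := by positivity
  have hh : 1 / (n : ℝ) ≤ 1 / 4 := by gcongr
  have hkn : k / n = k * (1 / n) := by ring
  have hkn1 : k / (n + 1 : ℕ) * (1 + 1 / n) = k * (1 / n) := by push_cast; field_simp
  have hsucc : poissonMass n (n + 1 : ℕ) = poissonMass n n * (massRatio n 1 * (1 + 1 / n)) := by
    rw [← poissonMass_add_eq hn0]; push_cast; rfl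
  have hlow : poissonLower (n + 1) (n + 1 : ℕ) =
      poissonLower n (n + 1) + poissonMass n (n + 1 : ℕ) := by
    simp [poissonLower, Finset.sum_range_succ]
  rw [integerCdf, integerCdf, hlow, poissonMass_succ_self, hsucc, hkn]
  set p := poissonMass n n
  set E := massRatio n 1
  generalize poissonLower n (n + 1) = Q' at *
  generalize poissonLower n n = Q at *
  generalize 1 / (n : ℝ) = h at *
  set e := E - (1 - (1 + 1 ^ 2 / 2) * h + (1 ^ 2 + 5 / 6 * 1 ^ 3 + 1 ^ 4 / 8) * h ^ 2) with he
  set d := Q' - Q + p * (1 - (1 ^ 2 / 2 + 1 ^ 3 / 6) * h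
    + (1 ^ 3 / 3 + 5 / 24 * 1 ^ 4 + 1 ^ 5 / 40) * h ^ 2) with hd
  have hEe : E = 1 - 3 / 2 * h + 47 / 24 * h ^ 2 + e := by rw [he]; ring
  have key : Q' + p * (E * (1 + h)) + (1 / 3 + k / (n + 1 : ℕ)) * (p * (E * (1 + h)))
      - (Q + (1 / 3 + k * h) * p) - p * (h ^ 2 * (2 / 45 - 3 / 2 * k))
      = d + p * (e * (4 / 3 * (1 + h) + k * h) + 47 / 24 * (4 / 3 + k) * h ^ 3) := by
    have h1 : Q' + p * (E * (1 + h)) + (1 / 3 + k / (n + 1 : ℕ)) * (p * (E * (1 + h)))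
      = Q' + p * E * (4 / 3 * (1 + h) + k / (n + 1 : ℕ) * (1 + h)) := by ring
    rw [h1, hkn1, hd, hEe]
    ring
  rw [key]
  obtain ⟨hk1, hk2⟩ := abs_le.1 hk
  have h1 : |4 / 3 * (1 + h) + k * h| ≤ 2 := by
    rw [abs_le]; constructor <;> nlinarith
  have h2 : |47 / 24 * (4 / 3 + k) * h ^ 3| ≤ 5 * h ^ 3 := by
    rw [abs_mul, abs_of_pos (by positivity : 0 < h ^ 3)]
    gcongr
    rw [abs_le]; constructor <;> linarith
  calc _ ≤ p * (40 * h ^ 3) + p * (40 * h ^ 3 * 2 + 5 * h ^ 3) := by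
        refine (abs_add_le _ _).trans (add_le_add hJ ?_)
        rw [abs_mul, abs_of_pos hp0]
        gcongr
        refine (abs_add_le _ _).trans (add_le_add ?_ h2)
        rw [abs_mul]
        gcongr
    _ = _ := by ring

lemma eventually_abs_error_le {a : ℝ} (ha : 0 < a) :
    ∀ᶠ n : ℕ in atTop, poissonMass n n * (125 * (1 / (n : ℝ)) ^ 3)
      < poissonMass n n * ((1 / (n : ℝ)) ^ 2 * a) := by
  filter_upwards [eventually_gt_atTop 0,
    (tendsto_const_div_atTop_nhds_zero_nat (125 : ℝ)).eventually_lt_const ha] with n hn h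
  have hp0 := poissonMass_self_pos hn
  have : 125 * (1 / (n : ℝ)) ^ 3 = (1 / (n : ℝ)) ^ 2 * (125 / n) := by ring
  rw [this]
  gcongr

lemma eventually_integerCdf_lt_half {k : ℝ} (hk : |k| ≤ 1) (hk' : k < 4 / 135) :
    ∀ᶠ n : ℕ in atTop, integerCdf k n < 1 / 2 := by
  have hinc : ∀ᶠ n : ℕ in atTop, integerCdf k n < integerCdf k (n + 1) := by
    filter_upwards [eventually_ge_atTop 4,
      eventually_abs_error_le (a := 2 / 45 - 3 / 2 * k) (by linarith)] with n hn he
    have := (abs_le.1 (abs_integerCdf_succ_sub_le hn hk)).1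
    linarith
  obtain ⟨N, hN⟩ := eventually_atTop.1 hinc
  filter_upwards [eventually_ge_atTop N] with n hn
  have hmono : Monotone fun i => integerCdf k (i + (n + 1)) :=
    monotone_nat_of_le_succ fun i => by
      have := (hN (i + (n + 1)) (by omega)).le
      rwa [show i + 1 + (n + 1) = i + (n + 1) + 1 by ring]
  have := hmono.ge_of_tendsto ((tendsto_add_atTop_iff_nat (n + 1)).2 (tendsto_integerCdf k)) 0
  rw [zero_add] at this
  exact (hN n hn).trans_le this

lemma eventually_half_le_integerCdf {k : ℝ} (hk : |k| ≤ 1) (hk' : 4 / 135 < k) :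
    ∀ᶠ n : ℕ in atTop, 1 / 2 ≤ integerCdf k n := by
  have hdec : ∀ᶠ n : ℕ in atTop, integerCdf k (n + 1) ≤ integerCdf k n := by
    filter_upwards [eventually_ge_atTop 4,
      eventually_abs_error_le (a := 3 / 2 * k - 2 / 45) (by linarith)] with n hn he
    have := (abs_le.1 (abs_integerCdf_succ_sub_le hn hk)).2
    linarith
  obtain ⟨N, hN⟩ := eventually_atTop.1 hdec
  filter_upwards [eventually_ge_atTop N] with n hn
  have hanti : Antitone fun i => integerCdf k (i + n) :=
    antitone_nat_of_succ_le fun i => by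
      have := hN (i + n) (by omega)
      rwa [show i + 1 + n = i + n + 1 by ring]
  simpa using hanti.le_of_tendsto ((tendsto_add_atTop_iff_nat n).2 (tendsto_integerCdf k)) 0

/-- Combination of the lower bounds for the two terms of the distribution function of `Z_{n + x}`,
where `h = 1 / n`. -/
lemma expansion_lower_bound {x h k ε s q E : ℝ} (hh0 : 0 < h) (hh : h ≤ 1 / 4) (hε : 60 * h ≤ ε)
    (hx : |x| ≤ 1) (hs : s = x + 1 / 3 + q) (hs0 : 0 ≤ s) (hs1 : s ≤ 1)
    (hq1 : k * h - h ^ 2 ≤ q) (hq2 : q ≤ 2 * h)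
    (hE : -(40 * h ^ 3) ≤ E - (1 - (x + x ^ 2 / 2) * h
      + (x ^ 2 + 5 / 6 * x ^ 3 + x ^ 4 / 8) * h ^ 2)) :
    1 / 3 + (k - ε / 2) * h ≤ -(40 * h ^ 3) - (x - (x ^ 2 / 2 + x ^ 3 / 6) * h
      + (x ^ 3 / 3 + 5 / 24 * x ^ 4 + x ^ 5 / 40) * h ^ 2) + s * (E * (1 + x * h)) := by
  have hx3 : |x ^ 3| ≤ 1 := by rw [abs_pow]; exact pow_le_one₀ (abs_nonneg _) hx
  have hx5 : |x ^ 5| ≤ 1 := by rw [abs_pow]; exact pow_le_one₀ (abs_nonneg _) hx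
  have hxh : |x * h| ≤ 1 * (1 / 4) := by rw [abs_mul, abs_of_pos hh0]; gcongr
  obtain ⟨hx1, hx2⟩ := abs_le.1 hx
  obtain ⟨hx31, hx32⟩ := abs_le.1 hx3
  obtain ⟨hx51, hx52⟩ := abs_le.1 hx5
  obtain ⟨hxh1, hxh2⟩ := abs_le.1 hxh
  have hxsq : x ^ 2 ≤ 1 := by nlinarith
  have hx4 : x ^ 4 ≤ 1 := by
    rw [show x ^ 4 = (x ^ 2) ^ 2 by ring]; exact pow_le_one₀ (sq_nonneg x) hxsq
  have hx40 : 0 ≤ x ^ 4 := by positivity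
  have hx20 : 0 ≤ x ^ 2 := sq_nonneg x
  have hh2 : 0 < h ^ 2 := by positivity
  have hh3 : 40 * h ^ 3 ≤ 10 * h ^ 2 := by
    have : h ^ 2 * h ≤ h ^ 2 * (1 / 4) := by gcongr
    linarith
  have hE1 : 1 - (x + x ^ 2 / 2) * h - 11 * h ^ 2 ≤ E := by
    have : 0 ≤ (x ^ 2 + 5 / 6 * x ^ 3 + x ^ 4 / 8 + 1) * h ^ 2 :=
      mul_nonneg (by linarith) hh2.le
    linarith
  have hE2 : 1 - x ^ 2 / 2 * h - 16 * h ^ 2 ≤ E * (1 + x * h) := by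
    have h1 := mul_le_mul_of_nonneg_right hE1 (by linarith : 0 ≤ 1 + x * h)
    have h2 : 0 ≤ h ^ 2 * (16 - (x ^ 2 + x ^ 3 / 2) - 11 * (1 + x * h)) :=
      mul_nonneg hh2.le (by linarith)
    linarith
  have hsE : s - (x + 1 / 3) * x ^ 2 / 2 * h - 17 * h ^ 2 ≤ s * (E * (1 + x * h)) := by
    have h1 := mul_le_mul_of_nonneg_left hE2 hs0
    have h2 : s * h ^ 2 ≤ 1 * h ^ 2 := by gcongr
    have h3 : q * (x ^ 2 / 2 * h) ≤ 2 * h * (1 / 2 * h) := by gcongr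
    have h4 : s * (x ^ 2 / 2 * h) = (x + 1 / 3) * x ^ 2 / 2 * h + q * (x ^ 2 / 2 * h) := by
      rw [hs]; ring
    linarith
  have hc2 : (x ^ 3 / 3 + 5 / 24 * x ^ 4 + x ^ 5 / 40) * h ^ 2 ≤ 1 * h ^ 2 := by
    gcongr; linarith
  have hx2h : 0 ≤ x ^ 2 * (1 - x) / 3 * h := by
    have : 0 ≤ 1 - x := by linarith
    positivity
  have hεh : 60 * h * h ≤ ε * h := by gcongr
  linarith

/-- The distribution function of `Z_{n + x}` at `n + s`, compared with its value for `x = 0`. -/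
lemma integerCdf_le_poissonLower_add {n : ℕ} {ε k l s : ℝ} (hn : 4 ≤ n) (hk0 : 0 ≤ k) (hk1 : k ≤ 1)
    (hε : 60 * (1 / (n : ℝ)) ≤ ε) (hl : |l - n| ≤ 1) (hs : s = l - n + 1 / 3 + k / l)
    (hs0 : 0 ≤ s) (hs1 : s ≤ 1) :
    integerCdf (k - ε / 2) n ≤ poissonLower n l + s * poissonMass n l := by
  obtain ⟨x, rfl⟩ : ∃ x, l = n + x := ⟨l - n, by ring⟩
  rw [add_sub_cancel_left] at hl hs
  have hn0 : 0 < n := by omega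
  have hn' : (4 : ℝ) ≤ n := by exact_mod_cast hn
  have hp0 := poissonMass_self_pos hn0
  have hJ := (abs_le.1 (abs_poissonLower_add_sub_le hn hl)).1
  have hE := (abs_le.1 (abs_massRatio_sub_le hn hl)).1
  obtain ⟨hx1, hx2⟩ := abs_le.1 hl
  have hh0 : 0 < 1 / (n : ℝ) := by positivity
  have hh : 1 / (n : ℝ) ≤ 1 / 4 := by gcongr
  have hkl1 : k * (1 / n) - (1 / (n : ℝ)) ^ 2 ≤ k / (n + x) := by
    have h1 : 1 / (n : ℝ) - (1 / n) ^ 2 ≤ 1 / (n + x) := by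
      rw [le_div_iff₀ (by linarith)]
      have : (1 / (n : ℝ) - (1 / n) ^ 2) * (n + x) = 1 - (1 / n) * (1 - x + x * (1 / n)) := by
        field_simp; ring
      rw [this]
      have : 0 ≤ 1 - x + x * (1 / n) := by nlinarith
      nlinarith
    have h2 : k * (1 / n - (1 / (n : ℝ)) ^ 2) ≤ k * (1 / (n + x)) := by gcongr
    have h3 : k * (1 / (n : ℝ)) ^ 2 ≤ 1 * (1 / (n : ℝ)) ^ 2 := by gcongr
    have h4 : k / (n + x) = k * (1 / (n + x)) := by ring
    linarith
  have hkl2 : k / (n + x) ≤ 2 * (1 / n) := by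
    rw [div_le_iff₀ (by linarith)]
    have : 2 * (1 / (n : ℝ)) * (n + x) = 2 + 2 * (1 / n) * x := by field_simp
    rw [this]; nlinarith
  rw [integerCdf, poissonMass_add_eq hn0, show x / n = x * (1 / n) by ring,
    show (k - ε / 2) / n = (k - ε / 2) * (1 / n) by ring]
  set p := poissonMass n n
  generalize massRatio n x = E at *
  generalize poissonLower n (n + x) = Q' at *
  generalize poissonLower n n = Q at *
  generalize 1 / (n : ℝ) = h at *
  generalize k / (n + x) = q at *
  have := mul_le_mul_of_nonneg_left
    (expansion_lower_bound hh0 hh hε hl hs hs0 hs1 hkl1 hkl2 hE) hp0.le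
  linarith

lemma eventually_half_le_zMeasure {ε : ℝ} (hε : 0 < ε) (hε1 : ε ≤ 1 / 2) :
    ∀ᶠ l : ℝ in atTop,
      (1 : ℝ≥0∞) / 2 ≤ zMeasure l (Iic (l + 1 / 3 + (4 / 135 + ε) / l)) := by
  have h1 := eventually_half_le_integerCdf (k := 4 / 135 + ε - ε / 2)
    (by rw [abs_le]; constructor <;> linarith) (by linarith)
  have h2 : ∀ᶠ n : ℕ in atTop, 60 * (1 / (n : ℝ)) ≤ ε := by
    simpa [div_eq_mul_inv] using
      (tendsto_const_div_atTop_nhds_zero_nat (60 : ℝ)).eventually_le_const hε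
  have h3 := (tendsto_nat_floor_atTop (α := ℝ)).comp (tendsto_atTop_mono' (atTop : Filter ℝ)
    (f₁ := id) (f₂ := fun l : ℝ => l + 1 / 3 + (4 / 135 + ε) / l)
    (by
      filter_upwards [eventually_gt_atTop 0] with l hl
      have : 0 ≤ (4 / 135 + ε) / l := by positivity
      simp only [id]
      linarith) tendsto_id)
  filter_upwards [h3.eventually (h1.and (h2.and (eventually_ge_atTop 4))), eventually_ge_atTop 3]
    with l ⟨h4, h5, h6⟩ hl
  simp only [Function.comp_apply] at h4 h5 h6
  have hq0 : 0 ≤ (4 / 135 + ε) / l := by positivity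
  have hq1 : (4 / 135 + ε) / l ≤ 1 / 3 := by rw [div_le_iff₀ (by linarith)]; linarith
  set t := l + 1 / 3 + (4 / 135 + ε) / l with ht
  have hn1 : (⌊t⌋₊ : ℝ) ≤ t := Nat.floor_le (by linarith)
  have hn2 : t < ⌊t⌋₊ + 1 := Nat.lt_floor_add_one t
  generalize ⌊t⌋₊ = n at *
  have key := integerCdf_le_poissonLower_add (k := 4 / 135 + ε) (l := l) (s := t - n) h6
    (by linarith) (by linarith) h5 (by rw [abs_le]; constructor <;> linarith)
    (by rw [ht]; ring) (by linarith) (by linarith)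
  have hz := zMeasure_Iic_nat_add (l := l) (by linarith) n (s := t - n) (by linarith)
    (by linarith)
  rw [add_sub_cancel] at hz
  rw [hz, ← ENNReal.ofReal_one, ← ENNReal.ofReal_ofNat, ← ENNReal.ofReal_div_of_pos (by norm_num)]
  exact ENNReal.ofReal_le_ofReal (h4.trans key)

lemma nonneg_of_half_le_zMeasure {l t : ℝ} (hl : 0 ≤ l)
    (ht : (1 : ℝ≥0∞) / 2 ≤ zMeasure l (Iic t)) : 0 ≤ t := by
  by_contra! h
  have h1 : zMeasure l (Iic t) ≤ zMeasure l (Iic 0) := measure_mono (Iic_subset_Iic.2 h.le)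
  have h2 : zMeasure l (Iic 0) = 0 := by
    simpa [poissonLower] using zMeasure_Iic_nat_add hl 0 le_rfl zero_le_one
  rw [h2] at h1
  exact absurd (ht.trans h1) (by simp)

lemma eventually_medianZ_le {ε : ℝ} (hε : 0 < ε) (hε1 : ε ≤ 1 / 2) :
    ∀ᶠ l : ℝ in atTop, l * (medianZ l - l - 1 / 3) ≤ 4 / 135 + ε := by
  filter_upwards [eventually_half_le_zMeasure hε hε1, eventually_gt_atTop 0] with l h hl
  have h1 : medianZ l ≤ l + 1 / 3 + (4 / 135 + ε) / l :=
    csInf_le ⟨0, fun t ht => nonneg_of_half_le_zMeasure hl.le ht⟩ h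
  have h2 : l * (medianZ l - l - 1 / 3) ≤ l * ((4 / 135 + ε) / l) := by
    gcongr; linarith
  rwa [mul_div_cancel₀ _ hl.ne'] at h2

lemma eventually_le_medianZ_natCast {ε : ℝ} (hε : 0 < ε) (hε1 : ε ≤ 1 / 2) :
    ∀ᶠ n : ℕ in atTop, 4 / 135 - ε ≤ (n : ℝ) * (medianZ n - n - 1 / 3) := by
  filter_upwards [eventually_integerCdf_lt_half (k := 4 / 135 - ε)
    (by rw [abs_le]; constructor <;> linarith) (by linarith),
    tendsto_natCast_atTop_atTop.eventually (eventually_half_le_zMeasure hε hε1),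
    eventually_ge_atTop 3] with n h1 h2 hn
  have hn' : (3 : ℝ) ≤ n := by exact_mod_cast hn
  have hs0 : 0 ≤ 1 / 3 + (4 / 135 - ε) / (n : ℝ) := by
    have : -(1 / 3) ≤ (4 / 135 - ε) / (n : ℝ) := by rw [le_div_iff₀ (by linarith)]; linarith
    linarith
  have hs1 : 1 / 3 + (4 / 135 - ε) / (n : ℝ) ≤ 1 := by
    have : (4 / 135 - ε) / (n : ℝ) ≤ 1 / 3 := by rw [div_le_iff₀ (by linarith)]; linarith
    linarith
  have hz := zMeasure_Iic_nat_add (l := n) n.cast_nonneg n hs0 hs1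
  have hlt : zMeasure n (Iic (n + (1 / 3 + (4 / 135 - ε) / (n : ℝ)))) < 1 / 2 := by
    rw [hz, ← ENNReal.ofReal_one, ← ENNReal.ofReal_ofNat,
      ← ENNReal.ofReal_div_of_pos (by norm_num)]
    exact (ENNReal.ofReal_lt_ofReal_iff (by norm_num)).2 h1
  have h3 : n + (1 / 3 + (4 / 135 - ε) / (n : ℝ)) ≤ medianZ n := by
    refine le_csInf ⟨_, h2⟩ fun t ht => ?_
    by_contra! htlt
    exact absurd (ht.trans (measure_mono (Iic_subset_Iic.2 htlt.le))) hlt.not_ge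
  have h4 : (n : ℝ) * ((4 / 135 - ε) / n) ≤ n * (medianZ n - n - 1 / 3) := by
    gcongr; linarith
  rwa [mul_div_cancel₀ _ (by linarith)] at h4

theorem limsup_median_jittered_poisson :
    Filter.limsup (fun l : ℝ => l * (medianZ l - l - 1 / 3)) atTop = 4 / 135 := by
  have hlow {ε : ℝ} (hε : 0 < ε) (hε1 : ε ≤ 1 / 2) :
      ∃ᶠ l : ℝ in atTop, 4 / 135 - ε ≤ l * (medianZ l - l - 1 / 3) :=
    tendsto_natCast_atTop_atTop.frequently (eventually_le_medianZ_natCast hε hε1).frequently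
  have hhalf : (0 : ℝ) < 1 / 2 := by norm_num
  apply le_antisymm
  · refine le_of_forall_pos_le_add fun ε hε => ?_
    have h := limsup_le_of_le (IsCoboundedUnder.of_frequently_ge (hlow hhalf le_rfl))
      (eventually_medianZ_le (lt_min hε hhalf) (min_le_right _ _))
    exact h.trans (by gcongr; exact min_le_left _ _)
  · refine le_of_forall_pos_le_add fun ε hε => ?_
    have h := le_limsup_of_frequently_le (hlow (lt_min hε hhalf) (min_le_right _ _))
      (isBoundedUnder_of_eventually_le (eventually_medianZ_le hhalf le_rfl))
    have := min_le_left ε (1 / 2)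
    linarith
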